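/- arXiv:2511.06689 — 2 statements merged into one kernel-verified Lean document; each statement's English description precedes it below -/
import Mathlib

section
/- Let K be a commutative ring and A = (a_{ij}) an n×n matrix over K, with c_k the total weight of all closed walks of length k in D(A) and ℓ_i the signed sum of weights of all linear subdigraphs of D(A) of length i. Then for every integer r > n, c_r + c_{r-1} ℓ_1 + c_{r-2} ℓ_2 + ⋯ + c_{r-n} ℓ_n = 0. -/
open Matrix BigOperators Finset

/-- The number of orbits of a permutation `σ` of a finite type, where fixed points
(loops) are counted as cycles: the number of nontrivial cycles in the cycle
decomposition plus the number of fixed points. -/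
def cyclesCount {α : Type*} [Fintype α] [DecidableEq α] (σ : Equiv.Perm α) : ℕ :=
  σ.cycleType.card + (Finset.univ.filter fun x => σ x = x).card

/-- `c_k`: the total weight of all closed walks of length `k ≥ 1` in `D(A)`;
a closed walk of length `k` is a function `f : ZMod k → Fin n`, with weight
`Π_{t ∈ ZMod k} a_{f(t), f(t+1)}`. (The value at `k = 0` is irrelevant.) -/
def closedWalkSum {K : Type*} [CommRing K] {n : ℕ} (A : Matrix (Fin n) (Fin n) K) : ℕ → K
  | 0 => 0
  | (k + 1) => ∑ f : ZMod (k + 1) → Fin n, ∏ t : ZMod (k + 1), A (f t) (f (t + 1))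

/-- `ℓ_i`: the signed sum of the weights of all linear subdigraphs of `D(A)` of
length `i`, i.e. `Σ_{S ⊆ [n], |S| = i} Σ_{σ ∈ Perm S} (−1)^{c(σ)} Π_{j ∈ S} a_{j,σ(j)}`. -/
def linearSubdigraphSum {K : Type*} [CommRing K] {n : ℕ} (A : Matrix (Fin n) (Fin n) K)
    (i : ℕ) : K :=
  ∑ S ∈ Finset.powersetCard i (Finset.univ : Finset (Fin n)),
    ∑ σ : Equiv.Perm {x // x ∈ S},
      (-1 : K) ^ cyclesCount σ * ∏ j : {x // x ∈ S}, A (j : Fin n) ((σ j : {x // x ∈ S}) : Fin n)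

theorem neg_one_pow_cyclesCount {α : Type*} [Fintype α] [DecidableEq α] (K : Type*) [CommRing K]
    (σ : Equiv.Perm α) :
    (-1 : K) ^ cyclesCount σ = (-1) ^ Fintype.card α * ((Equiv.Perm.sign σ : ℤ) : K) := by
  have hfixed : (Finset.univ.filter fun x => σ x = x).card + σ.cycleType.sum = Fintype.card α := by
    rw [Equiv.Perm.sum_cycleType, ← Finset.card_univ]
    exact Finset.card_filter_add_card_filter_not _
  rw [Equiv.Perm.sign_of_cycleType, ← hfixed, cyclesCount]
  push_cast
  rw [← pow_add, neg_one_pow_congr]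
  grind

theorem linearSubdigraphSum_eq_charpoly_coeff {K : Type*} [CommRing K] {n : ℕ}
    (A : Matrix (Fin n) (Fin n) K) {i : ℕ} (hi : i ≤ n) :
    linearSubdigraphSum A i = A.charpoly.coeff (n - i) := by
  have h := A.charpoly_coeff_eq_sum_minors i (by simpa using hi)
  rw [Fintype.card_fin] at h
  rw [h, linearSubdigraphSum, Finset.mul_sum]
  refine Finset.sum_congr rfl fun S hS => ?_
  rw [← Matrix.det_transpose, Matrix.det_apply', Finset.mul_sum]
  refine Finset.sum_congr rfl fun σ _ => ?_
  rw [neg_one_pow_cyclesCount, Fintype.card_coe, (Finset.mem_powersetCard.mp hS).2, mul_assoc]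
  rfl

theorem sum_walk_weight_mul {K ι : Type*} [CommRing K] [Fintype ι] [DecidableEq ι]
    (A : Matrix ι ι K) (k : ℕ) (g : ι → ι → K) :
    ∑ f : Fin (k + 1) → ι, (∏ t : Fin k, A (f t.castSucc) (f t.succ)) * g (f 0) (f (Fin.last k)) =
      ∑ i, ∑ j, (A ^ k) i j * g i j := by
  induction k generalizing g with
  | zero =>
    rw [← (Equiv.funUnique (Fin 1) ι).symm.sum_comp]
    simp [Matrix.one_apply]
  | succ k ih =>
    have hstep := ih fun i' j => ∑ i, A i i' * g i j
    rw [← (Fin.consEquiv fun _ => ι).sum_comp, Fintype.sum_prod_type, Finset.sum_comm]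
    simp only [Fin.consEquiv_apply, Fin.prod_univ_succ, Fin.castSucc_zero, Fin.cons_zero,
      Fin.cons_succ, ← Fin.succ_castSucc, ← Fin.succ_last]
    calc
      _ = ∑ f : Fin (k + 1) → ι, (∏ t : Fin k, A (f t.castSucc) (f t.succ)) *
            ∑ i, A i (f 0) * g i (f (Fin.last k)) := by
        refine Finset.sum_congr rfl fun f _ => ?_
        rw [Finset.mul_sum]
        exact Finset.sum_congr rfl fun i _ => by ring
      _ = _ := by
        rw [hstep]
        simp only [pow_succ', Matrix.mul_apply, Finset.mul_sum, Finset.sum_mul]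
        rw [Finset.sum_comm_cycle]
        refine Finset.sum_congr rfl fun i _ => ?_
        rw [Finset.sum_comm]
        exact Finset.sum_congr rfl fun j _ => Finset.sum_congr rfl fun i' _ => by ring

theorem closedWalkSum_eq_trace_pow {K : Type*} [CommRing K] {n : ℕ}
    (A : Matrix (Fin n) (Fin n) K) {k : ℕ} (hk : k ≠ 0) :
    closedWalkSum A k = (A ^ k).trace := by
  obtain ⟨k, rfl⟩ := Nat.exists_eq_succ_of_ne_zero hk
  have hwalk := sum_walk_weight_mul A k fun i j => A j i
  simp only [Nat.succ_eq_add_one, pow_succ, Matrix.trace, Matrix.diag_apply, Matrix.mul_apply]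
  rw [← hwalk]
  change ∑ f : Fin (k + 1) → Fin n, ∏ t : Fin (k + 1), A (f t) (f (t + 1)) = _
  simp only [Fin.prod_univ_castSucc, Fin.coeSucc_eq_succ, Fin.last_add_one]

/-- For `r > n`, `c_r + c_{r-1} ℓ_1 + c_{r-2} ℓ_2 + ⋯ + c_{r-n} ℓ_n = 0`. -/
theorem closedWalkSum_linearSubdigraphSum_of_gt {K : Type*} [CommRing K] {n : ℕ}
    (A : Matrix (Fin n) (Fin n) K) (r : ℕ) (hr : r > n) :
    closedWalkSum A r +
      ∑ i ∈ Finset.Icc 1 n, closedWalkSum A (r - i) * linearSubdigraphSum A i = 0 := by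
  have hcoeff : linearSubdigraphSum A 0 = 1 := by
    simp [linearSubdigraphSum, cyclesCount]
  have hsum : closedWalkSum A r +
      ∑ i ∈ Finset.Icc 1 n, closedWalkSum A (r - i) * linearSubdigraphSum A i =
      ∑ i ∈ Finset.range (n + 1), closedWalkSum A (r - i) * linearSubdigraphSum A i := by
    rw [Finset.range_eq_Ico, Finset.sum_eq_sum_Ico_succ_bot n.succ_pos, hcoeff, mul_one]
    rfl
  nontriviality K
  have hcayley := A.aeval_self_charpoly
  rw [Polynomial.aeval_eq_sum_range' (n := n + 1)
    (by simp)] at hcayley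
  have htrace := congrArg (fun M => (A ^ (r - n) * M).trace) hcayley
  simp only [Finset.mul_sum, Matrix.trace_sum, Matrix.mul_smul, Matrix.trace_smul, ← pow_add,
    mul_zero, Matrix.trace_zero, smul_eq_mul] at htrace
  rw [hsum, ← htrace, ← Finset.sum_range_reflect]
  refine Finset.sum_congr rfl fun i hi => ?_
  have hin : i ≤ n := Finset.mem_range_succ_iff.mp hi
  rw [closedWalkSum_eq_trace_pow A (by lia), linearSubdigraphSum_eq_charpoly_coeff A (by lia),
    mul_comm, show n - (n + 1 - 1 - i) = i by lia, show r - (n + 1 - 1 - i) = r - n + i by lia]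
end

section
/- Let K be a commutative ring and A = (a_{ij}) an n×n matrix over K, with c_k the total weight of all closed walks of length k in D(A) and ℓ_i the signed sum of weights of all linear subdigraphs of D(A) of length i. Then for every integer r with 1 ≤ r ≤ n, c_r + c_{r-1} ℓ_1 + c_{r-2} ℓ_2 + ⋯ + c_1 ℓ_{r-1} + r·ℓ_r = 0, where r·ℓ_r means the image of the natural number r in K times ℓ_r. -/
open Matrix BigOperators Finset

namespace Equiv.Perm

lemma sum_cycleType_add_card_fixed {α : Type*} [Fintype α] [DecidableEq α] (σ : Equiv.Perm α) :
    σ.cycleType.sum + (univ.filter fun x => σ x = x).card = Fintype.card α := by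
  have h := Finset.card_filter_add_card_filter_not (s := (univ : Finset α)) (fun x => σ x = x)
  rw [sum_cycleType, support, ← Finset.card_univ]
  lia

lemma neg_one_pow_cyclesCount {α : Type*} [Fintype α] [DecidableEq α] (R : Type*) [CommRing R]
    (σ : Equiv.Perm α) :
    (-1 : R) ^ cyclesCount σ = (-1) ^ Fintype.card α * ((sign σ : ℤ) : R) := by
  rw [sign_of_cycleType, ← sum_cycleType_add_card_fixed σ, cyclesCount]
  push_cast
  rw [← pow_add]
  apply neg_one_pow_congr
  grind

end Equiv.Perm

namespace Matrix

variable {R ι : Type*} [CommRing R] [Fintype ι] [DecidableEq ι]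

/-- **Jacobi's formula** for the formal derivative of the determinant of a polynomial matrix. -/
lemma derivative_det (M : Matrix ι ι (Polynomial R)) :
    Polynomial.derivative M.det = (M.adjugate * M.map Polynomial.derivative).trace := by
  have key (i : ι) : (M.adjugate * M.map Polynomial.derivative) i i =
      (M.updateCol i fun k => Polynomial.derivative (M k i)).det := by
    rw [← cramer_apply, cramer_eq_adjugate_mulVec]
    rfl
  have hprod (σ : Equiv.Perm ι) (i : ι) :
      ∏ j, M.updateCol i (fun k => Polynomial.derivative (M k i)) (σ j) j =
        (∏ j ∈ univ.erase i, M (σ j) j) * Polynomial.derivative (M (σ i) i) := by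
    rw [← prod_erase_mul _ _ (mem_univ i), updateCol_self]
    congr 1
    exact prod_congr rfl fun j hj => updateCol_ne (ne_of_mem_erase hj)
  simp only [trace, diag_apply, key, det_apply, Polynomial.derivative_sum,
    Polynomial.derivative_smul, Polynomial.derivative_prod_finset, hprod, smul_sum, Units.smul_def]
  exact sum_comm

/-- The coefficients of the adjugate of `1 - X • A`. -/
lemma map_coeff_adjugate_one_sub_X_smul (A : Matrix ι ι R) (k : ℕ) :
    (adjugate (1 - (Polynomial.X : Polynomial R) • A.map Polynomial.C)).map
        (fun p => p.coeff k) =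
      ∑ i ∈ range (k + 1), A.charpolyRev.coeff i • A ^ (k - i) := by
  set N := adjugate (1 - (Polynomial.X : Polynomial R) • A.map Polynomial.C) with hN
  have h : N = A.charpolyRev • 1 + (Polynomial.X : Polynomial R) • (N * A.map Polynomial.C) := by
    rw [charpolyRev, ← adjugate_mul, ← hN, mul_sub, mul_one, mul_smul_comm, sub_add_cancel]
  induction k with
  | zero =>
    ext a b
    have := congrArg (fun p => p.coeff 0) (congrFun (congrFun h a) b)
    simpa [one_apply, apply_ite, ite_apply] using this
  | succ k ih =>
    have hs : N.map (fun p => p.coeff (k + 1)) =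
        A.charpolyRev.coeff (k + 1) • 1 + N.map (fun p => p.coeff k) * A := by
      ext a b
      have := congrArg (fun p => p.coeff (k + 1)) (congrFun (congrFun h a) b)
      simpa [mul_apply, Polynomial.finsetSum_coeff, one_apply, apply_ite, ite_apply] using this
    rw [hs, ih, sum_range_succ _ (k + 1), add_comm, sum_mul]
    congr 1
    · refine sum_congr rfl fun i hi => ?_
      rw [smul_mul_assoc, ← pow_succ, Nat.sub_add_comm (by simpa [Nat.lt_succ_iff] using hi)]
    · simp

/-- **Newton's identities** for the reverse characteristic polynomial and the power traces. -/
lemma succ_mul_coeff_charpolyRev (A : Matrix ι ι R) (k : ℕ) :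
    ((k + 1 : ℕ) : R) * A.charpolyRev.coeff (k + 1) =
      -∑ i ∈ range (k + 1), A.charpolyRev.coeff i * (A ^ (k + 1 - i)).trace := by
  have hd := derivative_det (1 - (Polynomial.X : Polynomial R) • A.map Polynomial.C)
  have hm : (1 - (Polynomial.X : Polynomial R) • A.map Polynomial.C).map Polynomial.derivative =
      -A.map Polynomial.C := by
    ext a b : 2
    by_cases hab : a = b <;> simp [hab]
  set N := adjugate (1 - (Polynomial.X : Polynomial R) • A.map Polynomial.C) with hN
  have hc : (N * -A.map Polynomial.C).trace.coeff k =
      -(N.map (fun p => p.coeff k) * A).trace := by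
    simp [trace, mul_apply, Polynomial.finsetSum_coeff]
  rw [hm] at hd
  have := congrArg (fun p => p.coeff k) hd
  simp only [Polynomial.coeff_derivative, hc] at this
  rw [hN, map_coeff_adjugate_one_sub_X_smul, sum_mul, trace_sum] at this
  rw [charpolyRev, mul_comm]
  push_cast
  rw [this]
  congr 1
  refine sum_congr rfl fun i hi => ?_
  rw [smul_mul_assoc, ← pow_succ, trace_smul, smul_eq_mul, charpolyRev,
    Nat.sub_add_comm (by simpa [Nat.lt_succ_iff] using hi)]

lemma sum_prod_walk_mul (A : Matrix ι ι R) (k : ℕ) (g : ι → ι → R) :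
    ∑ f : Fin (k + 1) → ι, (∏ t : Fin k, A (f t.castSucc) (f t.succ)) * g (f 0) (f (Fin.last k)) =
      ∑ i, ∑ j, (A ^ k) i j * g i j := by
  induction k generalizing g with
  | zero =>
    rw [← (Equiv.funUnique (Fin 1) ι).symm.sum_comp]
    simp [one_apply]
  | succ k ih =>
    rw [← (Fin.consEquiv fun _ => ι).sum_comp, Fintype.sum_prod_type]
    refine sum_congr rfl fun a _ => ?_
    have := ih fun i j => A a i * g a j
    simp only [Fin.consEquiv_apply, Fin.prod_univ_succ, Fin.castSucc_zero, Fin.cons_zero,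
      Fin.cons_succ, ← Fin.succ_castSucc, ← Fin.succ_last]
    calc _ = _ := sum_congr rfl fun f _ => by ring
      _ = _ := this
      _ = _ := by
        rw [sum_comm]
        refine sum_congr rfl fun j _ => ?_
        rw [pow_succ', mul_apply, sum_mul]
        exact sum_congr rfl fun i _ => by ring

end Matrix

lemma closedWalkSum_succ_eq_trace {K : Type*} [CommRing K] {n : ℕ}
    (A : Matrix (Fin n) (Fin n) K) (k : ℕ) : closedWalkSum A (k + 1) = (A ^ (k + 1)).trace := by
  have h := A.sum_prod_walk_mul k fun i j => A j i
  rw [pow_succ, trace]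
  simp only [diag_apply, mul_apply]
  rw [← h]
  change ∑ f : Fin (k + 1) → Fin n, ∏ t : Fin (k + 1), A (f t) (f (t + 1)) = _
  simp [Fin.prod_univ_castSucc]

lemma linearSubdigraphSum_eq_coeff_charpolyRev {K : Type*} [CommRing K] {n : ℕ}
    (A : Matrix (Fin n) (Fin n) K) (i : ℕ) :
    linearSubdigraphSum A i = A.charpolyRev.coeff i := by
  have h : A.charpolyRev =
      (1 + (Polynomial.X : Polynomial K) • (-A).map Polynomial.C).det := by
    rw [charpolyRev, Matrix.map_neg _ (map_neg Polynomial.C), smul_neg, sub_eq_add_neg]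
  rw [h, coeff_det_one_add_X_smul_eq_sum_minors, linearSubdigraphSum]
  refine sum_congr rfl fun S _ => ?_
  rw [submatrix_neg, Pi.neg_apply, Pi.neg_apply, det_neg, ← det_transpose, det_apply', mul_sum]
  refine sum_congr rfl fun σ _ => ?_
  rw [Equiv.Perm.neg_one_pow_cyclesCount, mul_assoc]
  rfl

/-- For `1 ≤ r ≤ n`, `c_r + c_{r-1} ℓ_1 + ⋯ + c_1 ℓ_{r-1} + r·ℓ_r = 0`. -/
theorem closedWalkSum_linearSubdigraphSum_of_le {K : Type*} [CommRing K] {n : ℕ}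
    (A : Matrix (Fin n) (Fin n) K) (r : ℕ) (hr1 : 1 ≤ r) (hr2 : r ≤ n) :
    closedWalkSum A r +
      (∑ i ∈ Finset.Icc 1 (r - 1), closedWalkSum A (r - i) * linearSubdigraphSum A i) +
      (r : K) * linearSubdigraphSum A r = 0 := by
  obtain ⟨k, rfl⟩ := Nat.exists_eq_add_of_le' hr1
  have h := A.succ_mul_coeff_charpolyRev k
  rw [linearSubdigraphSum_eq_coeff_charpolyRev, h, closedWalkSum_succ_eq_trace,
    sum_range_succ', Nat.add_sub_cancel, range_eq_Ico,
    sum_Ico_add' (fun i => A.charpolyRev.coeff i * (A ^ (k + 1 - i)).trace) 0 k 1]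
  have h0 : A.charpolyRev.coeff 0 = 1 := by
    rw [Polynomial.coeff_zero_eq_eval_zero, eval_charpolyRev]
  have hs : ∑ i ∈ Icc 1 k, closedWalkSum A (k + 1 - i) * linearSubdigraphSum A i =
      ∑ i ∈ Ico (0 + 1) (k + 1), A.charpolyRev.coeff i * (A ^ (k + 1 - i)).trace := by
    refine sum_congr rfl fun i hi => ?_
    rw [Nat.sub_add_comm (mem_Icc.mp hi).2, closedWalkSum_succ_eq_trace,
      linearSubdigraphSum_eq_coeff_charpolyRev, mul_comm]
  rw [hs, h0]
  rw [Nat.sub_zero]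
  ring
end
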